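/- Let p be a prime and let α_p := ∑' (n : ℕ), (p : ℤ_p)^(v_p(n!)) in ℤ_p. Then the p-adic digit sequence of α_p is not eventually zero: for every N there exists an index i ≥ N such that d_i(α_p) ≠ 0. -/

import Mathlib

open Nat

lemma aux_vmono (p : ℕ) [Fact p.Prime] {a b : ℕ} (h : a ≤ b) :
    padicValNat p (a !) ≤ padicValNat p (b !) :=
  (padicValNat_dvd_iff_le (factorial_ne_zero b)).1
    (pow_padicValNat_dvd.trans (factorial_dvd_factorial h))

lemma aux_step (p : ℕ) [Fact p.Prime] (m : ℕ) :
    ∑ n ∈ Finset.range (p * (m + 1)), p ^ padicValNat p (n !) =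
      ∑ n ∈ Finset.range (p * m), p ^ padicValNat p (n !) +
        p ^ (padicValNat p (m !) + m + 1) := by
  rw [mul_add, mul_one, Finset.sum_range_add]
  congr 1
  rw [Finset.sum_congr rfl (g := fun _ => p ^ (padicValNat p (m !) + m))]
  · simp [_root_.pow_succ, mul_comm]
  · intro r hr
    rw [padicValNat_factorial_mul_add m (Finset.mem_range.1 hr), padicValNat_factorial_mul]

lemma aux_lt (p : ℕ) [hp : Fact p.Prime] (m : ℕ) :
    ∑ n ∈ Finset.range (p * m), p ^ padicValNat p (n !) <
      p ^ (padicValNat p (m !) + m + 1) := by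
  have h2 := hp.out.two_le
  induction m with
  | zero => simp; omega
  | succ m ih =>
    rw [aux_step]
    have h1 : p ^ (padicValNat p (m !) + m + 1 + 1) ≤
        p ^ (padicValNat p ((m + 1) !) + (m + 1) + 1) := by
      apply Nat.pow_le_pow_right (by omega)
      have := aux_vmono p (Nat.le_succ m)
      simp only [Nat.succ_eq_add_one] at this
      omega
    rw [_root_.pow_succ p (padicValNat p (m !) + m + 1)] at h1
    have h3 := Nat.mul_le_mul_left (p ^ (padicValNat p (m !) + m + 1)) h2
    omega

lemma aux_summable (p : ℕ) [hp : Fact p.Prime] :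
    Summable (fun n : ℕ => (p : ℤ_[p]) ^ (padicValNat p (n !))) := by
  apply NonarchimedeanAddGroup.summable_of_tendsto_cofinite_zero
  rw [Nat.cofinite_eq_atTop]
  have h1 : Filter.Tendsto (fun n : ℕ => padicValNat p (n !)) Filter.atTop Filter.atTop := by
    apply Filter.tendsto_atTop_atTop.2
    intro b
    refine ⟨p * b, fun n hn => ?_⟩
    have := aux_vmono p hn
    rw [padicValNat_factorial_mul] at this
    omega
  refine Filter.Tendsto.comp (g := fun k : ℕ => (p : ℤ_[p]) ^ k) ?_ h1
  apply tendsto_pow_atTop_nhds_zero_of_norm_lt_one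
  rw [PadicInt.norm_p]
  exact inv_lt_one_of_one_lt₀ (by exact_mod_cast hp.out.one_lt)

lemma aux_tail (p : ℕ) [hp : Fact p.Prime] (m : ℕ) :
    (∑' n : ℕ, (p : ℤ_[p]) ^ (padicValNat p (n !))) -
      ((∑ n ∈ Finset.range (p * m), p ^ padicValNat p (n !) : ℕ) : ℤ_[p]) ∈
      Ideal.span {(p : ℤ_[p]) ^ (padicValNat p (m !) + m)} := by
  rw [← (aux_summable p).sum_add_tsum_nat_add (p * m)]
  push_cast
  rw [add_sub_cancel_left, ← PadicInt.norm_le_pow_iff_mem_span_pow]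
  apply IsUltrametricDist.norm_tsum_le_of_forall_le_of_nonneg
  · positivity
  · intro n
    rw [PadicInt.norm_le_pow_iff_mem_span_pow, Ideal.mem_span_singleton]
    apply pow_dvd_pow
    rw [← padicValNat_factorial_mul]
    exact aux_vmono p (by omega)

theorem padic_digits_not_eventually_zero (p : ℕ) [Fact p.Prime] :
    ∀ N : ℕ, ∃ i : ℕ, N ≤ i ∧
      (PadicInt.appr (∑' n : ℕ, (p : ℤ_[p]) ^ (padicValNat p (n !))) (i + 1)) / p ^ i ≠ 0 := by
  intro N
  have hp2 := (Fact.out : p.Prime).two_le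
  refine ⟨padicValNat p (N !) + N + 1, by omega, ?_⟩
  set α := ∑' n : ℕ, (p : ℤ_[p]) ^ (padicValNat p (n !)) with hα
  set i := padicValNat p (N !) + N + 1 with hi
  have hmem := aux_tail p (N + 2)
  have hstep := aux_step p N
  have hstep1 := aux_step p (N + 1)
  have hlt := aux_lt p N
  have hv1 := aux_vmono p (Nat.le_succ N)
  have hv2 : padicValNat p ((N + 1) !) ≤ padicValNat p ((N + 2) !) := aux_vmono p (Nat.le_succ (N + 1))
  simp only [Nat.succ_eq_add_one] at hv1
  set S := ∑ n ∈ Finset.range (p * (N + 2)), p ^ padicValNat p (n !) with hS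
  have hmem' : α - (S : ℤ_[p]) ∈ Ideal.span {(p : ℤ_[p]) ^ (i + 1)} := by
    rw [Ideal.mem_span_singleton] at hmem ⊢
    exact (pow_dvd_pow _ (by omega)).trans hmem
  have hz := PadicInt.zmod_congr_of_sub_mem_span (i + 1) α _ _ (PadicInt.appr_spec (i + 1) α) hmem'
  rw [ZMod.natCast_eq_natCast_iff] at hz
  have hST : S ≡ ∑ n ∈ Finset.range (p * N), p ^ padicValNat p (n !) + p ^ i
      [MOD p ^ (i + 1)] := by
    rw [hstep1, hstep]
    have : p ^ (i + 1) ∣ p ^ (padicValNat p ((N + 1) !) + (N + 1) + 1) :=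
      pow_dvd_pow _ (by omega)
    exact ((Nat.modEq_zero_iff_dvd.2 this).add_left
      (∑ n ∈ Finset.range (p * N), p ^ padicValNat p (n !) + p ^ i))
  have heq := (hz.trans hST).eq_of_lt_of_lt (PadicInt.appr_lt _ _) (by
    have h3 := Nat.mul_le_mul_left (p ^ i) hp2
    have h4 : p ^ (i + 1) = p ^ i * p := _root_.pow_succ p i
    rw [← hi] at hlt
    omega)
  rw [heq, Nat.add_div_right _ (by positivity)]
  exact Nat.succ_ne_zero _
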